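/- (Separability inequality for canonical two-qubit states.) Let σ₁, σ₂, σ₃ be the Pauli matrices, let d⃗ ∈ ℝ³ and let S be a real 3×3 matrix, and suppose that ρ = (1/4)(𝟙⊗𝟙 + Σ_{i=1}^{3} dᵢ σᵢ⊗𝟙 + Σ_{i,j=1}^{3} S_{ij} σᵢ⊗σⱼ) is positive semidefinite (so ρ is a canonical two-qubit state). Set Q = S Sᵀ, d = |d⃗|, and when d ≠ 0 let d̂ = d⃗/d; define ũ = 1 − tr Q + 2 d̂ᵀ Q d̂ and q̃ = 1 − 2 tr Q − 8 √(det Q) + 2 tr(Q²) − (tr Q)². Then ρ is separable if and only if d⁴ − 2ũ d² + q̃ ≥ 0, where ρ is called separable if it can be written as a finite convex combination ρ = Σᵢ pᵢ αᵢ ⊗ βᵢ with pᵢ ≥ 0, Σᵢ pᵢ = 1, each αᵢ and βᵢ a 2×2 complex positive semidefinite matrix of trace 1, and ⊗ the Kronecker product. (When d = 0 the term 2 d̂ᵀ Q d̂ in ũ is taken to be 0, consistently since it is multiplied by d².) -/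

import Mathlib

open Matrix Kronecker
open scoped ComplexOrder

/-- The Pauli matrices `σ₁, σ₂, σ₃`. -/
def pauli : Fin 3 → Matrix (Fin 2) (Fin 2) ℂ
  | 0 => !![0, 1; 1, 0]
  | 1 => !![0, -Complex.I; Complex.I, 0]
  | 2 => !![1, 0; 0, -1]

/-- A 4×4 complex matrix (indexed by `Fin 2 × Fin 2`, the first factor being the
first qubit) is separable if it is a finite convex combination of Kronecker
products of 2×2 positive semidefinite trace-1 matrices. -/
def IsSeparableTwoQubit (ρ : Matrix (Fin 2 × Fin 2) (Fin 2 × Fin 2) ℂ) : Prop :=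
  ∃ (n : ℕ) (p : Fin n → ℝ) (α β : Fin n → Matrix (Fin 2) (Fin 2) ℂ),
    (∀ i, 0 ≤ p i) ∧ (∑ i, p i = 1) ∧
    (∀ i, (α i).PosSemidef ∧ (α i).trace = 1) ∧
    (∀ i, (β i).PosSemidef ∧ (β i).trace = 1) ∧
    ρ = ∑ i, (p i : ℂ) • (α i ⊗ₖ β i)

section Takagi

variable {E : Type*} [NormedAddCommGroup E] [InnerProductSpace ℂ E] [FiniteDimensional ℂ E]

theorem exists_norm_eq_one_forall_bilin_eq_inner [Nontrivial E] (B : E →ₗ[ℂ] E →ₗ[ℂ] ℂ)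
    (hB : ∀ x y, B x y = B y x) :
    ∃ (v : E) (l : ℝ), ‖v‖ = 1 ∧ 0 ≤ l ∧ ∀ w, B v w = l * inner ℂ v w := by
  have hcont : Continuous fun x : E => (B x x).re := by
    have h1 : Continuous fun p : E × E => B p.1 p.2 := by
      let B' : E →L[ℂ] E →L[ℂ] ℂ :=
        LinearMap.toContinuousLinearMap
          ((LinearMap.toContinuousLinearMap : (E →ₗ[ℂ] ℂ) ≃ₗ[ℂ] (E →L[ℂ] ℂ)).toLinearMap ∘ₗ B)
      have : Continuous fun p : E × E => B' p.1 p.2 := by fun_prop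
      exact this
    exact Complex.continuous_re.comp (h1.comp (continuous_id.prodMk continuous_id))
  have : ProperSpace E := FiniteDimensional.proper ℂ E
  obtain ⟨x0, hx0⟩ := exists_ne (0 : E)
  have hne : (Metric.sphere (0 : E) 1).Nonempty :=
    ⟨((‖x0‖⁻¹ : ℝ) : ℂ) • x0, by
      simp [norm_smul, hx0]⟩
  obtain ⟨v, hv, hmax⟩ :=
    (isCompact_sphere (0 : E) 1).exists_isMaxOn hne hcont.continuousOn
  have hv1 : ‖v‖ = 1 := by simpa using hv
  set l : ℝ := (B v v).re with hl
  have hle : ∀ x, (B x x).re ≤ l * ‖x‖ ^ 2 := by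
    intro x
    by_cases hx : x = 0
    · simp [hx]
    have hxn : ‖x‖ ≠ 0 := by simpa using hx
    have h := hmax (show ((‖x‖⁻¹ : ℝ) : ℂ) • x ∈ Metric.sphere (0 : E) 1 by
      simp [norm_smul, hx])
    simp only [Set.mem_ofPred_eq, map_smul, LinearMap.smul_apply, smul_eq_mul,
      Complex.re_ofReal_mul] at h
    have h2 : (B x x).re = ‖x‖ ^ 2 * (‖x‖⁻¹ * (‖x‖⁻¹ * (B x x).re)) := by
      field_simp
    rw [h2, mul_comm l]
    gcongr
  have hre : ∀ w, (B v w).re = l * (inner ℂ v w).re := by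
    intro w
    have hquad : ∀ t : ℝ, 2 * t * ((B v w).re - l * (inner ℂ v w).re) ≤
        t ^ 2 * (l * ‖w‖ ^ 2 - (B w w).re) := by
      intro t
      have h := hle (v + (t : ℂ) • w)
      have hn : ‖v + (t : ℂ) • w‖ ^ 2 = 1 + 2 * t * (inner ℂ v w).re + t ^ 2 * ‖w‖ ^ 2 := by
        rw [@norm_add_sq ℂ, hv1, inner_smul_right, norm_smul]
        simp [mul_pow]
        ring
      rw [hn] at h
      simp only [map_add, map_smul, LinearMap.add_apply, LinearMap.smul_apply, smul_eq_mul,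
        Complex.add_re, Complex.re_ofReal_mul, hB w v] at h
      nlinarith
    set c := (B v w).re - l * (inner ℂ v w).re with hc
    set m := l * ‖w‖ ^ 2 - (B w w).re with hm
    have hm0 : 0 ≤ m := by linarith [hle w]
    have h := hquad (c / (m + 1))
    have h3 : 2 * (c / (m + 1)) * c - (c / (m + 1)) ^ 2 * m = c ^ 2 * ((m + 2) / (m + 1) ^ 2) := by
      field_simp
      ring
    have h4 : 0 < (m + 2) / (m + 1) ^ 2 := by positivity
    have h5 : c ^ 2 ≤ 0 := by
      by_contra! h6
      have := mul_pos h6 h4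
      linarith
    have : c = 0 := by nlinarith
    linarith
  refine ⟨v, l, hv1, ?_, ?_⟩
  · have := hle (Complex.I • v)
    simp only [map_smul, LinearMap.smul_apply, smul_eq_mul, norm_smul, Complex.norm_I, hv1,
      ← mul_assoc, Complex.I_mul_I] at this
    simp at this
    linarith
  · intro w
    apply Complex.ext
    · simpa using hre w
    · have := hre (Complex.I • w)
      simp only [map_smul, smul_eq_mul, inner_smul_right] at this
      simp at this
      simp
      linarith

theorem exists_orthonormal_forall_bilin_eq_inner (B : E →ₗ[ℂ] E →ₗ[ℂ] ℂ)
    (hB : ∀ x y, B x y = B y x) (k : ℕ) (hk : k ≤ Module.finrank ℂ E) :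
    ∃ (e : Fin k → E) (l : Fin k → ℝ), Orthonormal ℂ e ∧ (∀ i, 0 ≤ l i) ∧
      ∀ i w, B (e i) w = l i * inner ℂ (e i) w := by
  induction k with
  | zero => exact ⟨Fin.elim0, Fin.elim0, ⟨fun i => i.elim0, fun i => i.elim0⟩,
      fun i => i.elim0, fun i => i.elim0⟩
  | succ k ih =>
    obtain ⟨e, l, he, hl, hBe⟩ := ih (by omega)
    obtain ⟨F, hF⟩ : ∃ F, F = (Submodule.span ℂ (Set.range e))ᗮ := ⟨_, rfl⟩
    have hfin : 0 < Module.finrank ℂ F := by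
      have h1 := Submodule.finrank_add_finrank_orthogonal (Submodule.span ℂ (Set.range e))
      have h2 := finrank_span_eq_card he.linearIndependent
      rw [h2, Fintype.card_fin, ← hF] at h1
      omega
    have : Nontrivial F := Module.nontrivial_of_finrank_pos hfin
    obtain ⟨v, m, hv, hm, hvm⟩ := exists_norm_eq_one_forall_bilin_eq_inner
      (B.domRestrict₁₂ F F) (fun x y => hB x y)
    have hvF : (v : E) ∈ (Submodule.span ℂ (Set.range e))ᗮ := hF ▸ v.2
    have hev : ∀ i, inner ℂ (e i) (v : E) = 0 := fun i =>
      (Submodule.mem_orthogonal _ _).1 hvF _ (Submodule.subset_span ⟨i, rfl⟩)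
    have hve : ∀ i, inner ℂ (v : E) (e i) = 0 := fun i => by
      rw [← inner_conj_symm, hev, map_zero]
    have hvw : ∀ w, B v w = m * inner ℂ (v : E) w := by
      intro w
      obtain ⟨y, hy, z, hz, rfl⟩ :=
        (Submodule.span ℂ (Set.range e)).exists_add_mem_mem_orthogonal w
      have hy' : B v y = 0 ∧ inner ℂ (v : E) y = 0 := by
        induction hy using Submodule.span_induction with
        | mem x hx =>
          obtain ⟨i, rfl⟩ := hx
          rw [hB, hBe, hev, hve]; simp
        | zero => simp
        | add x y _ _ hx hy => simp [hx, hy]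
        | smul a x _ hx => simp [hx]
      have hz' := hvm ⟨z, by rwa [hF]⟩
      simp only [LinearMap.domRestrict₁₂_apply, Submodule.coe_inner] at hz'
      rw [map_add, inner_add_right, hy'.1, hy'.2, hz']
      simp
    refine ⟨Fin.cons (v : E) e, Fin.cons m l, ?_, ?_, ?_⟩
    · rw [orthonormal_iff_ite] at he ⊢
      intro i j
      have hv' : ‖(v : E)‖ = 1 := hv
      refine Fin.cases ?_ (fun i => ?_) i <;> refine Fin.cases ?_ (fun j => ?_) j
      · simp [inner_self_eq_norm_sq_to_K, hv']
      · simp [hve, (Fin.succ_ne_zero j).symm]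
      · simp [hev]
      · simp [he]
    · intro i
      refine Fin.cases ?_ (fun i => ?_) i
      · simpa using hm
      · simpa using hl i
    · intro i w
      refine Fin.cases ?_ (fun i => ?_) i
      · simpa using hvw w
      · simpa using hBe i w

end Takagi

/-- **Autonne–Takagi factorization** of a complex symmetric matrix. -/
theorem Matrix.IsSymm.exists_unitary_transpose_mul_mul_eq_diagonal {ι : Type*} [Fintype ι]
    [DecidableEq ι] {T : Matrix ι ι ℂ} (hT : T.IsSymm) :
    ∃ (U : Matrix ι ι ℂ) (l : ι → ℝ), U * Uᴴ = 1 ∧ (∀ i, 0 ≤ l i) ∧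
      Uᵀ * T * U = diagonal fun i => (l i : ℂ) := by
  let B : EuclideanSpace ℂ ι →ₗ[ℂ] EuclideanSpace ℂ ι →ₗ[ℂ] ℂ :=
    LinearMap.mk₂ ℂ (fun x y => x.ofLp ⬝ᵥ T *ᵥ y.ofLp)
      (by intros; simp [add_dotProduct]) (by intros; simp)
      (by intros; simp [mulVec_add]) (by intros; simp [mulVec_smul])
  have hBapp : ∀ x y, B x y = x.ofLp ⬝ᵥ T *ᵥ y.ofLp := fun _ _ => rfl
  obtain ⟨e, l, he, hl, hBe⟩ := exists_orthonormal_forall_bilin_eq_inner B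
    (by intro x y
        rw [hBapp, hBapp, dotProduct_mulVec, ← mulVec_transpose, hT.eq, dotProduct_comm])
    (Fintype.card ι) (by simp)
  let f := Fintype.equivFin ι
  refine ⟨of fun i j => e (f j) i, fun i => l (f i), ?_, fun i => hl _, ?_⟩
  · rw [mul_eq_one_comm]
    ext i j
    have := orthonormal_iff_ite.1 he (f i) (f j)
    rw [PiLp.inner_apply] at this
    simp only [RCLike.inner_apply, EmbeddingLike.apply_eq_iff_eq] at this
    rw [Matrix.mul_apply, Matrix.one_apply, ← this]
    simp [mul_comm]
  · ext i j
    have h1 := hBe (f i) (e (f j))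
    rw [orthonormal_iff_ite.1 he, hBapp, dotProduct_mulVec] at h1
    simp only [EmbeddingLike.apply_eq_iff_eq, mul_ite, mul_one, mul_zero] at h1
    rw [diagonal_apply, ← h1]
    rfl

theorem exists_norm_one_mul_add_mul_eq {a b t : ℝ} (ha : 0 ≤ a) (hb : 0 ≤ b) (h1 : |a - b| ≤ t)
    (h2 : t ≤ a + b) : ∃ z w : ℂ, ‖z‖ = 1 ∧ ‖w‖ = 1 ∧ z * a + w * b = t := by
  have ht : 0 ≤ t := (abs_nonneg _).trans h1
  let g : ℝ → ℝ := fun θ => ‖(a : ℂ) + Complex.exp (θ * Complex.I) * b‖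
  have hg : Continuous g := by fun_prop
  have hg0 : g 0 = a + b := by
    simp only [g]
    rw [Complex.ofReal_zero, zero_mul, Complex.exp_zero, one_mul, ← Complex.ofReal_add,
      Complex.norm_real, Real.norm_of_nonneg (by positivity)]
  have hgpi : g Real.pi = |a - b| := by
    simp only [g]
    rw [Complex.exp_pi_mul_I, neg_one_mul, ← sub_eq_add_neg, ← Complex.ofReal_sub,
      Complex.norm_real, Real.norm_eq_abs]
  obtain ⟨θ, -, hθ⟩ := intermediate_value_Icc' Real.pi_pos.le hg.continuousOn
    (show t ∈ Set.Icc (g Real.pi) (g 0) by rw [hg0, hgpi]; exact ⟨h1, h2⟩)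
  have hw : ‖Complex.exp (θ * Complex.I)‖ = 1 := Complex.norm_exp_ofReal_mul_I θ
  set c : ℂ := a + Complex.exp (θ * Complex.I) * b with hc
  have hθ' : ‖c‖ = t := hθ
  have hu : ‖Complex.exp (((-c.arg : ℝ) : ℂ) * Complex.I)‖ = 1 := Complex.norm_exp_ofReal_mul_I _
  refine ⟨Complex.exp (((-c.arg : ℝ) : ℂ) * Complex.I),
    Complex.exp (((-c.arg : ℝ) : ℂ) * Complex.I) * Complex.exp (θ * Complex.I), hu, ?_, ?_⟩
  · rw [norm_mul, hu, hw, mul_one]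
  · have h3 : Complex.exp (((-c.arg : ℝ) : ℂ) * Complex.I) * c = ‖c‖ := by
      conv_lhs => rw [← Complex.norm_mul_exp_arg_mul_I c]
      rw [mul_left_comm, ← Complex.exp_add]
      simp
    rw [← hθ', ← h3, hc]
    ring

/-- Four nonnegative lengths, none exceeding the sum of the others, close up to a quadrilateral. -/
theorem exists_norm_one_quadrilateral {a b c d : ℝ} (ha : 0 ≤ a) (hb : 0 ≤ b) (hc : 0 ≤ c)
    (hd : 0 ≤ d) (h1 : a ≤ b + c + d) (h2 : b ≤ a + c + d) (h3 : c ≤ a + b + d)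
    (h4 : d ≤ a + b + c) :
    ∃ x y z w : ℂ, ‖x‖ = 1 ∧ ‖y‖ = 1 ∧ ‖z‖ = 1 ∧ ‖w‖ = 1 ∧
      x * a + y * b + z * c + w * d = 0 := by
  obtain ⟨x, y, hx, hy, hxy⟩ := exists_norm_one_mul_add_mul_eq ha hb
    (le_max_left |a - b| |c - d|)
    (max_le (abs_le.2 ⟨by linarith, by linarith⟩) (abs_le.2 ⟨by linarith, by linarith⟩))
  obtain ⟨z, w, hz, hw, hzw⟩ := exists_norm_one_mul_add_mul_eq hc hd
    (le_max_right |a - b| |c - d|)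
    (max_le (abs_le.2 ⟨by linarith, by linarith⟩) (abs_le.2 ⟨by linarith, by linarith⟩))
  refine ⟨x, y, -z, -w, hx, hy, by rwa [norm_neg], by rwa [norm_neg], ?_⟩
  linear_combination hxy - hzw

theorem le_sum_of_quartic_nonneg {a b c d : ℝ} (hb : 0 ≤ b) (hc : 0 ≤ c) (hd : 0 ≤ d)
    (h : 0 ≤ (a ^ 2 + b ^ 2 + c ^ 2 + d ^ 2) ^ 2 - 2 * (a ^ 4 + b ^ 4 + c ^ 4 + d ^ 4)
      + 8 * (a * b * c * d)) : a ≤ b + c + d := by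
  by_contra! hlt
  have h1 : 0 < a + c + d - b := by linarith
  have h2 : 0 < a + b + d - c := by linarith
  have h3 : 0 < a + b + c - d := by linarith
  have h4 : 0 < a - b - c - d := by linarith
  have := mul_pos (mul_pos h1 h2) (mul_pos h3 h4)
  nlinarith

theorem exists_norm_one_sq_eq {z : ℂ} (hz : ‖z‖ = 1) : ∃ u : ℂ, ‖u‖ = 1 ∧ u ^ 2 = z := by
  obtain ⟨u, hu⟩ := IsAlgClosed.exists_pow_nat_eq z (n := 2) (by norm_num)
  refine ⟨u, ?_, hu⟩
  rw [← hu, norm_pow] at hz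
  exact (pow_eq_one_iff_of_nonneg (norm_nonneg _) two_ne_zero).1 hz

theorem Matrix.PosSemidef.exists_smul_trace_one {A : Matrix (Fin 2) (Fin 2) ℂ}
    (hA : A.PosSemidef) :
    ∃ (t : ℝ) (α : Matrix (Fin 2) (Fin 2) ℂ), 0 ≤ t ∧ α.PosSemidef ∧ α.trace = 1 ∧
      A = (t : ℂ) • α := by
  obtain ⟨ht, him⟩ := Complex.nonneg_iff.1 hA.trace_nonneg
  have htr : A.trace = (A.trace.re : ℂ) := Complex.ext rfl him.symm
  by_cases h0 : A.trace = 0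
  · refine ⟨0, (1 / 2 : ℝ) • 1, le_rfl, PosSemidef.one.smul (by norm_num), ?_, ?_⟩
    · rw [trace_smul]; simp
    · simpa using hA.trace_eq_zero_iff.1 h0
  · have hre : A.trace.re ≠ 0 := fun h => h0 (by rw [htr, h, Complex.ofReal_zero])
    refine ⟨A.trace.re, A.trace.re⁻¹ • A, ht, hA.smul (inv_nonneg.2 ht), ?_, ?_⟩
    · rw [trace_smul, Complex.real_smul, Complex.ofReal_inv, ← htr, inv_mul_cancel₀ h0]
    · ext i j
      simp [hre]

theorem isSeparableTwoQubit_sum_kronecker {ι : Type*} [Fintype ι]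
    (A B : ι → Matrix (Fin 2) (Fin 2) ℂ) (hA : ∀ i, (A i).PosSemidef)
    (hB : ∀ i, (B i).PosSemidef) (htr : (∑ i, A i ⊗ₖ B i).trace = 1) :
    IsSeparableTwoQubit (∑ i, A i ⊗ₖ B i) := by
  choose s α hs hα hαt hAα using fun i => (hA i).exists_smul_trace_one
  choose t β ht hβ hβt hBβ using fun i => (hB i).exists_smul_trace_one
  let f := (Fintype.equivFin ι).symm
  refine ⟨Fintype.card ι, fun i => s (f i) * t (f i), fun i => α (f i), fun i => β (f i),
    fun i => mul_nonneg (hs _) (ht _), ?_, fun i => ⟨hα _, hαt _⟩, fun i => ⟨hβ _, hβt _⟩, ?_⟩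
  · rw [f.sum_comp fun i => s i * t i]
    have : ((∑ i, s i * t i : ℝ) : ℂ) = 1 := by
      rw [← htr, trace_sum]
      push_cast
      refine Finset.sum_congr rfl fun i _ => ?_
      rw [trace_kronecker, hAα, hBβ, trace_smul, trace_smul, hαt, hβt]
      simp
    exact_mod_cast this
  · rw [f.sum_comp fun i => ((s i * t i : ℝ) : ℂ) • (α i ⊗ₖ β i)]
    refine Finset.sum_congr rfl fun i _ => ?_
    conv_lhs => rw [hAα, hBβ]
    rw [smul_kronecker, kronecker_smul, smul_smul, Complex.ofReal_mul]

theorem exists_eq_mul_of_det_eq_zero {z : Fin 2 × Fin 2 → ℂ}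
    (h : z (0, 0) * z (1, 1) = z (0, 1) * z (1, 0)) :
    ∃ a b : Fin 2 → ℂ, ∀ x, z x = a x.1 * b x.2 := by
  by_cases h00 : z (0, 0) = 0
  · rw [h00, zero_mul, eq_comm, mul_eq_zero] at h
    rcases h with h | h
    · refine ⟨![0, 1], ![z (1, 0), z (1, 1)], ?_⟩
      rintro ⟨i, j⟩
      fin_cases i <;> fin_cases j <;> simp [h00, h]
    · refine ⟨![z (0, 1), z (1, 1)], ![0, 1], ?_⟩
      rintro ⟨i, j⟩
      fin_cases i <;> fin_cases j <;> simp [h00, h]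
  · refine ⟨![1, z (1, 0) / z (0, 0)], ![z (0, 0), z (0, 1)], ?_⟩
    rintro ⟨i, j⟩
    fin_cases i <;> fin_cases j <;> simp [h00]
    field_simp
    linear_combination h

theorem isSeparableTwoQubit_mul_conjTranspose {ι : Type*} [Fintype ι]
    (Z : Matrix (Fin 2 × Fin 2) ι ℂ) (htr : (Z * Zᴴ).trace = 1)
    (hZ : ∀ k, Z (0, 0) k * Z (1, 1) k = Z (0, 1) k * Z (1, 0) k) :
    IsSeparableTwoQubit (Z * Zᴴ) := by
  choose a b hab using fun k => exists_eq_mul_of_det_eq_zero (z := fun x => Z x k) (hZ k)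
  have h : Z * Zᴴ = ∑ k, vecMulVec (a k) (star (a k)) ⊗ₖ vecMulVec (b k) (star (b k)) := by
    ext x y
    rw [Matrix.mul_apply, Matrix.sum_apply]
    refine Finset.sum_congr rfl fun k _ => ?_
    rw [conjTranspose_apply, hab, hab]
    simp [vecMulVec_apply]
    ring
  rw [h] at htr ⊢
  exact isSeparableTwoQubit_sum_kronecker _ _ (fun _ => posSemidef_vecMulVec_self_star _)
    (fun _ => posSemidef_vecMulVec_self_star _) htr

/-- Wootters' criterion in terms of the spin-flipped matrix. -/
theorem isSeparableTwoQubit_of_spinFlip {ρ : Matrix (Fin 2 × Fin 2) (Fin 2 × Fin 2) ℂ}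
    (hρ : ρ.PosSemidef) (htr : ρ.trace = 1) {R : Matrix (Fin 2 × Fin 2) (Fin 2 × Fin 2) ℂ}
    (hR : R = (pauli 1 ⊗ₖ pauli 1) * ρᵀ * (pauli 1 ⊗ₖ pauli 1)) {s : ℝ} (hs : 0 ≤ s)
    (h : (ρ * R).trace ^ 2 - 2 * ((ρ * R) * (ρ * R)).trace + 8 * ρ.det = s) :
    IsSeparableTwoQubit ρ := by
  obtain ⟨V, hV⟩ : ∃ V, ρ = V * Vᴴ := by
    open scoped MatrixOrder in
    obtain ⟨A, hA⟩ := CStarAlgebra.nonneg_iff_eq_star_mul_self.mp hρ.nonneg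
    exact ⟨Aᴴ, by rw [hA, conjTranspose_conjTranspose, star_eq_conjTranspose]⟩
  set F : Matrix (Fin 2 × Fin 2) (Fin 2 × Fin 2) ℂ := pauli 1 ⊗ₖ pauli 1 with hF
  have hFapp : ∀ x y, F x y = pauli 1 x.1 y.1 * pauli 1 x.2 y.2 := fun _ _ => rfl
  have hFT : Fᵀ = F := by
    rw [hF]
    ext ⟨i, i'⟩ ⟨j, j'⟩
    fin_cases i <;> fin_cases i' <;> fin_cases j <;> fin_cases j' <;> simp [pauli]
  have hFH : Fᴴ = F := by
    rw [hF]
    ext ⟨i, i'⟩ ⟨j, j'⟩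
    fin_cases i <;> fin_cases i' <;> fin_cases j <;> fin_cases j' <;> simp [pauli]
  have hFdet : F.det = 1 := by
    rw [hF, det_kronecker]
    simp [pauli, det_fin_two]
  obtain ⟨U, l, hU, hl, hD⟩ := Matrix.IsSymm.exists_unitary_transpose_mul_mul_eq_diagonal
    (T := Vᵀ * F * V) (by
      rw [IsSymm, transpose_mul, transpose_mul, hFT, transpose_transpose, mul_assoc])
  set D : Matrix (Fin 2 × Fin 2) (Fin 2 × Fin 2) ℂ := diagonal fun i => (l i : ℂ) with hDdef
  obtain ⟨W, hW⟩ : ∃ W, W = V * U := ⟨_, rfl⟩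
  have hρW : ρ = W * Wᴴ := by
    rw [hW, conjTranspose_mul, mul_assoc, ← mul_assoc U, hU, one_mul, hV]
  have hWD : Wᵀ * F * W = D := by
    rw [← hD, hW, transpose_mul]
    simp only [mul_assoc]
  have hDH : Dᴴ = D := by
    rw [hDdef, diagonal_conjTranspose]
    congr 1
    ext i
    simp
  have hWD' : Wᴴ * F * Wᴴᵀ = D := by
    rw [← hDH, ← hWD]
    simp only [conjTranspose_mul, hFH, mul_assoc]
    rfl
  have hρR : ρ * R = W * (D * (Wᵀ * F)) := by
    rw [hR, hρW, transpose_mul, ← hWD']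
    simp only [mul_assoc]
  have htr1 : (ρ * R).trace = ∑ i, (l i : ℂ) ^ 2 := by
    rw [hρR, trace_mul_comm, mul_assoc, hWD, hDdef, diagonal_mul_diagonal, trace_diagonal]
    simp only [sq]
  have htr2 : ((ρ * R) * (ρ * R)).trace = ∑ i, (l i : ℂ) ^ 4 := by
    have : (ρ * R) * (ρ * R) = W * (D * D * D * (Wᵀ * F)) := by
      rw [hρR]
      conv_rhs => rw [mul_assoc D D, mul_assoc D, mul_assoc D D]; arg 2; arg 2; arg 1; rw [← hWD]
      simp only [mul_assoc]
    rw [this, trace_mul_comm, mul_assoc, hWD, hDdef]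
    simp only [diagonal_mul_diagonal, trace_diagonal]
    refine Finset.sum_congr rfl fun i _ => by ring
  have hdet : ρ.det = ∏ i, (l i : ℂ) := by
    have h1 : W.det ^ 2 = ((∏ i, l i : ℝ) : ℂ) := by
      have := congrArg Matrix.det hWD
      rw [det_mul, det_mul, det_transpose, hFdet, hDdef, det_diagonal] at this
      push_cast
      rw [← this]
      ring
    have h2 : ‖W.det‖ ^ 2 = ∏ i, l i := by
      rw [← norm_pow, h1, Complex.norm_real,
        Real.norm_of_nonneg (Finset.prod_nonneg fun i _ => hl i)]
    rw [hρW, det_mul, det_conjTranspose, ← Complex.ofReal_prod, ← h2]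
    simpa using Complex.mul_conj' W.det
  rw [htr1, htr2, hdet] at h
  simp only [Fintype.sum_prod_type, Fintype.prod_prod_type, Fin.sum_univ_two,
    Fin.prod_univ_two] at h
  have hquart : 0 ≤ (l (0, 0) ^ 2 + l (0, 1) ^ 2 + l (1, 0) ^ 2 + l (1, 1) ^ 2) ^ 2
      - 2 * (l (0, 0) ^ 4 + l (0, 1) ^ 4 + l (1, 0) ^ 4 + l (1, 1) ^ 4)
      + 8 * (l (0, 0) * l (0, 1) * l (1, 0) * l (1, 1)) := by
    convert hs using 1
    rw [← Complex.ofReal_inj, ← h]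
    push_cast
    ring
  obtain ⟨z₀, z₁, z₂, z₃, hz₀, hz₁, hz₂, hz₃, hz⟩ := exists_norm_one_quadrilateral
    (hl (0, 0)) (hl (0, 1)) (hl (1, 0)) (hl (1, 1))
    (le_sum_of_quartic_nonneg (hl _) (hl _) (hl _) (by linarith))
    (le_sum_of_quartic_nonneg (hl _) (hl _) (hl _) (by linarith))
    (le_sum_of_quartic_nonneg (hl _) (hl _) (hl _) (by linarith))
    (le_sum_of_quartic_nonneg (hl _) (hl _) (hl _) (by linarith))
  obtain ⟨u₀, hu₀, rfl⟩ := exists_norm_one_sq_eq hz₀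
  obtain ⟨u₁, hu₁, rfl⟩ := exists_norm_one_sq_eq hz₁
  obtain ⟨u₂, hu₂, rfl⟩ := exists_norm_one_sq_eq hz₂
  obtain ⟨u₃, hu₃, rfl⟩ := exists_norm_one_sq_eq hz₃
  let u : Fin 2 × Fin 2 → ℂ := fun x => !![u₀, u₁; u₂, u₃] x.1 x.2
  have hu : ∀ x, u x * star (u x) = 1 := by
    rintro ⟨i, j⟩
    have key : ∀ v : ℂ, ‖v‖ = 1 → v * star v = 1 := fun v hv => by
      simpa [hv] using Complex.mul_conj' v
    fin_cases i <;> fin_cases j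
    exacts [key _ hu₀, key _ hu₁, key _ hu₂, key _ hu₃]
  let H : Matrix (Fin 2 × Fin 2) (Fin 2 × Fin 2) ℂ :=
    (1 / 2 : ℂ) • (!![1, 1; 1, -1] ⊗ₖ !![1, 1; 1, -1])
  have hH : H * Hᴴ = 1 := by
    ext ⟨i, i'⟩ ⟨j, j'⟩
    fin_cases i <;> fin_cases i' <;> fin_cases j <;> fin_cases j' <;>
      norm_num [H, Matrix.mul_apply, Fintype.sum_prod_type, Matrix.one_apply]
  have hZ : ρ = (W * diagonal u * H) * (W * diagonal u * H)ᴴ := by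
    have hdiag : diagonal u * (diagonal u)ᴴ = 1 := by
      rw [diagonal_conjTranspose, diagonal_mul_diagonal, ← diagonal_one]
      congr 1
      ext x
      exact hu x
    rw [conjTranspose_mul, mul_assoc _ H, ← mul_assoc H, hH, one_mul, conjTranspose_mul,
      mul_assoc W, ← mul_assoc (diagonal u), hdiag, one_mul, hρW]
  have hZF : (W * diagonal u * H)ᵀ * F * (W * diagonal u * H)
      = Hᵀ * (diagonal u * D * diagonal u) * H := by
    rw [← hWD]
    simp only [transpose_mul, diagonal_transpose, mul_assoc]
  rw [hZ] at htr ⊢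
  refine isSeparableTwoQubit_mul_conjTranspose _ htr fun k => ?_
  have h1 := congrFun (congrFun hZF k) k
  generalize W * diagonal u * H = Z at h1
  have hl' : (Zᵀ * F * Z) k k =
      2 * (Z (0, 1) k * Z (1, 0) k - Z (0, 0) k * Z (1, 1) k) := by
    simp [Matrix.mul_apply, Fintype.sum_prod_type, hFapp, pauli]
    ring_nf
  have hr : (Hᵀ * (diagonal u * D * diagonal u) * H) k k = 0 := by
    have hH2 : ∀ x, H x k ^ 2 = 1 / 4 := by
      rintro ⟨i, i'⟩
      obtain ⟨j, j'⟩ := k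
      fin_cases i <;> fin_cases i' <;> fin_cases j <;> fin_cases j' <;> norm_num [H]
    rw [hDdef, diagonal_mul_diagonal, diagonal_mul_diagonal, Matrix.mul_apply]
    have : ∀ x, (Hᵀ * diagonal fun i => u i * (l i : ℂ) * u i) k x * H x k
        = 1 / 4 * (u x ^ 2 * l x) := by
      intro x
      rw [mul_diagonal, transpose_apply, ← hH2 x]
      ring
    simp only [this, Fintype.sum_prod_type, Fin.sum_univ_two]
    simp only [u, of_apply, cons_val', cons_val_zero, cons_val_one, cons_val_fin_one]
    linear_combination (1 / 4 : ℂ) * hz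
  rw [hl', hr] at h1
  linear_combination (-1 / 2 : ℂ) * h1

/-- The matrix of the canonical two-qubit state with Bloch vector `d` and correlation matrix `S`. -/
noncomputable def canonicalState (d : Fin 3 → ℝ) (S : Matrix (Fin 3) (Fin 3) ℝ) :
    Matrix (Fin 2 × Fin 2) (Fin 2 × Fin 2) ℂ :=
  (1 / 4 : ℂ) •
    ((1 : Matrix (Fin 2) (Fin 2) ℂ) ⊗ₖ (1 : Matrix (Fin 2) (Fin 2) ℂ)
      + ∑ i : Fin 3, (d i : ℂ) • (pauli i ⊗ₖ (1 : Matrix (Fin 2) (Fin 2) ℂ))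
      + ∑ i : Fin 3, ∑ j : Fin 3, (S i j : ℂ) • (pauli i ⊗ₖ pauli j))

/-- The separability polynomial, with `s` in the place of `√(det Q)`; for `s = det S` it is
`256 * det ρ`, and for `s = -det S` it is `256` times the determinant of the partial transpose. -/
def separabilityPoly (d : Fin 3 → ℝ) (S : Matrix (Fin 3) (Fin 3) ℝ) (s : ℝ) : ℝ :=
  (d ⬝ᵥ d) ^ 2 - 2 * (1 - (S * Sᵀ).trace) * (d ⬝ᵥ d) - 4 * (d ⬝ᵥ (S * Sᵀ) *ᵥ d)
    + (1 - 2 * (S * Sᵀ).trace - 8 * s + 2 * ((S * Sᵀ) * (S * Sᵀ)).trace - (S * Sᵀ).trace ^ 2)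

theorem det_fin_two_prod {R : Type*} [CommRing R]
    (M : Matrix (Fin 2 × Fin 2) (Fin 2 × Fin 2) R) :
    M.det = (!![M (0, 0) (0, 0), M (0, 0) (0, 1), M (0, 0) (1, 0), M (0, 0) (1, 1);
      M (0, 1) (0, 0), M (0, 1) (0, 1), M (0, 1) (1, 0), M (0, 1) (1, 1);
      M (1, 0) (0, 0), M (1, 0) (0, 1), M (1, 0) (1, 0), M (1, 0) (1, 1);
      M (1, 1) (0, 0), M (1, 1) (0, 1), M (1, 1) (1, 0), M (1, 1) (1, 1)] :
        Matrix (Fin 4) (Fin 4) R).det := by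
  rw [← Matrix.det_reindex_self (finProdFinEquiv (m := 2) (n := 2))]
  congr 1
  ext i j
  fin_cases i <;> fin_cases j <;> rfl

/-- The position of a basis state of two qubits in the lexicographic order. -/
def twoQubitIndex : Fin 2 × Fin 2 → Fin 4
  | (0, 0) => 0
  | (0, 1) => 1
  | (1, 0) => 2
  | (1, 1) => 3

theorem canonicalState_apply (d : Fin 3 → ℝ) (S : Matrix (Fin 3) (Fin 3) ℝ) (i j : Fin 2 × Fin 2) :
    canonicalState d S i j = (1 / 4) * (!![1 + d 2 + S 2 2, S 2 0 - Complex.I * S 2 1,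
        d 0 + S 0 2 - Complex.I * (d 1 + S 1 2), S 0 0 - S 1 1 - Complex.I * (S 0 1 + S 1 0);
      S 2 0 + Complex.I * S 2 1, 1 + d 2 - S 2 2,
        S 0 0 + S 1 1 + Complex.I * (S 0 1 - S 1 0), d 0 - S 0 2 - Complex.I * (d 1 - S 1 2);
      d 0 + S 0 2 + Complex.I * (d 1 + S 1 2), S 0 0 + S 1 1 - Complex.I * (S 0 1 - S 1 0),
        1 - d 2 - S 2 2, - S 2 0 + Complex.I * S 2 1;
      S 0 0 - S 1 1 + Complex.I * (S 0 1 + S 1 0), d 0 - S 0 2 + Complex.I * (d 1 - S 1 2),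
        - S 2 0 - Complex.I * S 2 1, 1 - d 2 + S 2 2] :
      Matrix (Fin 4) (Fin 4) ℂ) (twoQubitIndex i) (twoQubitIndex j) := by
  obtain ⟨i, i'⟩ := i
  obtain ⟨j, j'⟩ := j
  fin_cases i <;> fin_cases i' <;> fin_cases j <;> fin_cases j' <;>
    simp [canonicalState, Fin.sum_univ_succ, pauli, twoQubitIndex] <;>
    ring

theorem trace_canonicalState (d : Fin 3 → ℝ) (S : Matrix (Fin 3) (Fin 3) ℝ) :
    (canonicalState d S).trace = 1 := by
  simp [Matrix.trace, Fintype.sum_prod_type, canonicalState_apply, twoQubitIndex]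
  ring

set_option maxHeartbeats 4000000 in
theorem det_canonicalState (d : Fin 3 → ℝ) (S : Matrix (Fin 3) (Fin 3) ℝ) :
    256 * (canonicalState d S).det = separabilityPoly d S S.det := by
  rw [det_fin_two_prod]
  simp [Matrix.det_succ_row_zero, Fin.sum_univ_succ, canonicalState_apply,
    twoQubitIndex, separabilityPoly, dotProduct, Matrix.mulVec, Matrix.trace,
    Matrix.mul_apply, Fin.succAbove, -Complex.ofReal_add, -Complex.ofReal_mul]
  push_cast
  have h4 : Complex.I ^ 4 = 1 := Complex.I_pow_four
  ring_nf
  simp only [Complex.I_sq, h4]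
  ring

theorem spinFlip_canonicalState (d : Fin 3 → ℝ) (S : Matrix (Fin 3) (Fin 3) ℝ) :
    (pauli 1 ⊗ₖ pauli 1) * (canonicalState d S)ᵀ * (pauli 1 ⊗ₖ pauli 1) =
      canonicalState (-d) S := by
  ext ⟨i, i'⟩ ⟨j, j'⟩
  fin_cases i <;> fin_cases i' <;> fin_cases j <;> fin_cases j' <;>
    simp [Matrix.mul_apply, Fintype.sum_prod_type, canonicalState_apply, pauli,
      twoQubitIndex] <;>
    ring

set_option maxHeartbeats 4000000 in
theorem trace_sq_sub_two_mul_trace_canonicalState (d : Fin 3 → ℝ)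
    (S : Matrix (Fin 3) (Fin 3) ℝ) :
    32 * ((canonicalState d S * canonicalState (-d) S).trace ^ 2
      - 2 * (canonicalState d S * canonicalState (-d) S *
          (canonicalState d S * canonicalState (-d) S)).trace)
    = separabilityPoly d S (-3 * S.det) := by
  have h4 : Complex.I ^ 4 = 1 := Complex.I_pow_four
  simp [Matrix.mul_apply, Fintype.sum_prod_type, canonicalState_apply, twoQubitIndex,
    Matrix.trace, Fin.sum_univ_succ, separabilityPoly, dotProduct, Matrix.mulVec,
    Matrix.det_fin_three, -Complex.ofReal_add, -Complex.ofReal_mul]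
  push_cast
  ring_nf
  simp only [Complex.I_sq, h4]
  ring

theorem isSeparableTwoQubit_canonicalState {d : Fin 3 → ℝ} {S : Matrix (Fin 3) (Fin 3) ℝ}
    (hρ : (canonicalState d S).PosSemidef) (h : 0 ≤ separabilityPoly d S (-S.det)) :
    IsSeparableTwoQubit (canonicalState d S) := by
  refine isSeparableTwoQubit_of_spinFlip hρ (trace_canonicalState d S)
    (spinFlip_canonicalState d S).symm (s := separabilityPoly d S (-S.det) / 16)
    (by positivity) ?_
  have h1 := trace_sq_sub_two_mul_trace_canonicalState d S
  have h2 := det_canonicalState d S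
  have h3 : separabilityPoly d S (-S.det) =
      (separabilityPoly d S (-3 * S.det) + separabilityPoly d S S.det) / 2 := by
    rw [separabilityPoly, separabilityPoly, separabilityPoly]
    ring
  rw [h3]
  push_cast
  rw [← h1, ← h2]
  ring

/-- Transposition on the second qubit. -/
def partialTranspose (M : Matrix (Fin 2 × Fin 2) (Fin 2 × Fin 2) ℂ) :
    Matrix (Fin 2 × Fin 2) (Fin 2 × Fin 2) ℂ :=
  of fun x y => M (x.1, y.2) (y.1, x.2)

theorem IsSeparableTwoQubit.posSemidef_partialTranspose
    {ρ : Matrix (Fin 2 × Fin 2) (Fin 2 × Fin 2) ℂ} (h : IsSeparableTwoQubit ρ) :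
    (partialTranspose ρ).PosSemidef := by
  obtain ⟨n, p, α, β, hp, -, hα, hβ, rfl⟩ := h
  have : partialTranspose (∑ i, (p i : ℂ) • (α i ⊗ₖ β i)) =
      ∑ i, (p i : ℂ) • (α i ⊗ₖ (β i)ᵀ) := by
    ext x y
    simp [partialTranspose, Matrix.sum_apply]
  rw [this]
  exact posSemidef_sum _ fun i _ =>
    ((hα i).1.kronecker (hβ i).1.transpose).smul (Complex.zero_le_real.2 (hp i))

theorem partialTranspose_canonicalState (d : Fin 3 → ℝ) (S : Matrix (Fin 3) (Fin 3) ℝ) :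
    partialTranspose (canonicalState d S) = canonicalState d (S * diagonal ![1, -1, 1]) := by
  ext ⟨i, i'⟩ ⟨j, j'⟩
  fin_cases i <;> fin_cases i' <;> fin_cases j <;> fin_cases j' <;>
    simp [partialTranspose, canonicalState_apply, twoQubitIndex] <;>
    ring

theorem separabilityPoly_mul_diagonal (d : Fin 3 → ℝ) (S : Matrix (Fin 3) (Fin 3) ℝ) (s : ℝ) :
    separabilityPoly d (S * diagonal ![1, -1, 1]) s = separabilityPoly d S s := by
  have h : (S * diagonal ![1, -1, 1]) * (S * diagonal ![1, -1, 1])ᵀ = S * Sᵀ := by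
    rw [transpose_mul, diagonal_transpose, mul_assoc, ← mul_assoc (diagonal _),
      diagonal_mul_diagonal]
    have : (diagonal fun i => (![1, -1, 1] : Fin 3 → ℝ) i * (![1, -1, 1] : Fin 3 → ℝ) i) = 1 := by
      rw [← diagonal_one]
      congr 1
      ext i
      fin_cases i <;> simp
    rw [this, one_mul]
  rw [separabilityPoly, h, separabilityPoly]

theorem separabilityPoly_det_nonneg {d : Fin 3 → ℝ} {S : Matrix (Fin 3) (Fin 3) ℝ}
    (hρ : (canonicalState d S).PosSemidef) : 0 ≤ separabilityPoly d S S.det := by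
  have h := mul_nonneg (show (0 : ℂ) ≤ 256 by norm_num) hρ.det_nonneg
  rw [det_canonicalState] at h
  exact_mod_cast h

theorem isSeparableTwoQubit_canonicalState_iff {d : Fin 3 → ℝ} {S : Matrix (Fin 3) (Fin 3) ℝ}
    (hρ : (canonicalState d S).PosSemidef) :
    IsSeparableTwoQubit (canonicalState d S) ↔ 0 ≤ separabilityPoly d S |S.det| := by
  constructor
  · intro h
    have h1 := separabilityPoly_det_nonneg hρ
    have h2 := h.posSemidef_partialTranspose
    rw [partialTranspose_canonicalState] at h2
    have h3 := separabilityPoly_det_nonneg h2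
    rw [separabilityPoly_mul_diagonal, det_mul, det_diagonal] at h3
    simp only [Fin.prod_univ_three, cons_val_zero, cons_val_one, cons_val] at h3
    rcases abs_choice S.det with h4 | h4 <;> rw [h4]
    · exact h1
    · convert h3 using 2
      ring
  · intro h
    refine isSeparableTwoQubit_canonicalState hρ (h.trans ?_)
    rw [separabilityPoly, separabilityPoly]
    linarith [neg_abs_le S.det, le_abs_self S.det]

/-- **Separability inequality for canonical two-qubit states.**
Let `ρ = (1/4)(𝟙⊗𝟙 + Σᵢ dᵢ σᵢ⊗𝟙 + Σᵢⱼ Sᵢⱼ σᵢ⊗σⱼ)` be a canonical two-qubit state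
(positive semidefinite) with Bloch vector `d⃗ ∈ ℝ³` and correlation matrix
`S ∈ ℝ³ˣ³`.  Set `Q = S Sᵀ`, `d = ‖d⃗‖`, `ũ = 1 − tr Q + 2 d̂ᵀ Q d̂` (the skew term
taken to be `0` when `d = 0`) and `q̃ = 1 − 2 tr Q − 8 √(det Q) + 2 tr(Q²) − (tr Q)²`.
Then `ρ` is separable iff `d⁴ − 2ũ d² + q̃ ≥ 0`. -/
theorem canonical_two_qubit_separability
    (dvec : EuclideanSpace ℝ (Fin 3)) (S : Matrix (Fin 3) (Fin 3) ℝ)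
    (ρ : Matrix (Fin 2 × Fin 2) (Fin 2 × Fin 2) ℂ)
    (hρdef : ρ = (1 / 4 : ℂ) •
      ((1 : Matrix (Fin 2) (Fin 2) ℂ) ⊗ₖ (1 : Matrix (Fin 2) (Fin 2) ℂ)
        + ∑ i : Fin 3, (dvec i : ℂ) • (pauli i ⊗ₖ (1 : Matrix (Fin 2) (Fin 2) ℂ))
        + ∑ i : Fin 3, ∑ j : Fin 3, (S i j : ℂ) • (pauli i ⊗ₖ pauli j)))
    (hρpsd : ρ.PosSemidef)
    (Q : Matrix (Fin 3) (Fin 3) ℝ) (hQ : Q = S * Sᵀ)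
    (d u q : ℝ)
    (hd : d = ‖dvec‖)
    (hu : u = 1 - Q.trace +
      (if d = 0 then 0
       else 2 * ((fun i => dvec i / d) ⬝ᵥ Q.mulVec (fun i => dvec i / d))))
    (hq : q = 1 - 2 * Q.trace - 8 * Real.sqrt Q.det
      + 2 * (Q * Q).trace - Q.trace ^ 2) :
    IsSeparableTwoQubit ρ ↔ d ^ 4 - 2 * u * d ^ 2 + q ≥ 0 := by
  have hρ : ρ = canonicalState dvec.ofLp S := hρdef
  have hd2 : d ^ 2 = dvec.ofLp ⬝ᵥ dvec.ofLp := by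
    rw [hd, EuclideanSpace.real_norm_sq_eq]
    simp only [dotProduct, sq]
  have hu' : u * d ^ 2 = (1 - Q.trace) * d ^ 2 + 2 * (dvec.ofLp ⬝ᵥ Q *ᵥ dvec.ofLp) := by
    rw [hu]
    split_ifs with h0
    · have : dvec = 0 := by rwa [hd, norm_eq_zero] at h0
      simp [h0, this]
    · have : (fun i => dvec.ofLp i / d) = d⁻¹ • dvec.ofLp := by
        ext i
        simp [div_eq_inv_mul]
      rw [this, mulVec_smul, smul_dotProduct, dotProduct_smul, smul_eq_mul, smul_eq_mul]
      field_simp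
  have hsqrt : √Q.det = |S.det| := by
    rw [hQ, det_mul, det_transpose, Real.sqrt_mul_self_eq_abs]
  rw [hρ] at hρpsd ⊢
  rw [isSeparableTwoQubit_canonicalState_iff hρpsd, ge_iff_le]
  have : d ^ 4 - 2 * u * d ^ 2 + q = separabilityPoly dvec.ofLp S |S.det| := by
    rw [separabilityPoly, ← hQ, ← hsqrt, ← hd2, hq]
    linear_combination (-2) * hu'
  rw [this]
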